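/- arXiv:2303.14405 — 11 statements merged into one kernel-verified Lean document; each statement's English description precedes it below -/
import Mathlib

section
/- In an egoistic election game with a monotone WP function, if for every party i the first candidate x_{i,1} weakly surpasses every other candidate x_{i,t} (t ∈ {2,…,n_i}) of party i, then the profile (1,1,…,1) in which every party nominates its first candidate is a pure-strategy Nash equilibrium. -/
/-- In an egoistic election game with a monotone WP function, if for every party `i`
the first candidate `x_{i,1}` weakly surpasses every other candidate of party `i`
(i.e. it brings at least as much utility to party `i`'s supporters and at least as
much social utility), then the profile in which every party nominates its first
candidate is a pure-strategy Nash equilibrium.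

Encoding: parties are `Fin m`; party `i` has candidates `Fin (n i)` (index `0` is
the "first" candidate); `U i s j` is the utility candidate `s` of party `i` brings
to party `j`'s supporters; `u i s` is its social utility; `p σ i` is the winning
probability of party `i` at profile `σ`; `r i σ` is party `i`'s payoff. -/
theorem first_candidates_PSNE
    (m : ℕ) (hm : 2 ≤ m)
    (n : Fin m → ℕ) (hn : ∀ i, 2 ≤ n i)
    (U : (i : Fin m) → Fin (n i) → Fin m → ℝ)
    (hUpos : ∀ (i : Fin m) (s : Fin (n i)) (j : Fin m), 0 ≤ U i s j)
    (hsorted : ∀ (i : Fin m) (s t : Fin (n i)), s ≤ t → U i t i ≤ U i s i)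
    (hego : ∀ i j : Fin m, i ≠ j → ∀ (si : Fin (n i)) (sj : Fin (n j)), U j sj i < U i si i)
    (u : (i : Fin m) → Fin (n i) → ℝ)
    (hu : ∀ (i : Fin m) (s : Fin (n i)), u i s = ∑ j, U i s j)
    (p : ((i : Fin m) → Fin (n i)) → Fin m → ℝ)
    (hpnn : ∀ (σ : (i : Fin m) → Fin (n i)) (i : Fin m), 0 ≤ p σ i)
    (hpsum : ∀ σ : (i : Fin m) → Fin (n i), ∑ i, p σ i = 1)
    -- monotonicity (i): a unilateral switch to a candidate of weakly larger social
    -- utility does not decrease one's own winning probability and does not increase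
    -- anybody else's
    (hmono₁ : ∀ (σ : (i : Fin m) → Fin (n i)) (i : Fin m) (s' : Fin (n i)),
      u i (σ i) ≤ u i s' →
        p σ i ≤ p (Function.update σ i s') i ∧
        ∀ j, j ≠ i → p (Function.update σ i s') j ≤ p σ j)
    -- monotonicity (ii): within a profile, larger social utility means no smaller
    -- winning probability
    (hmono₂ : ∀ (σ : (i : Fin m) → Fin (n i)) (i j : Fin m),
      u j (σ j) < u i (σ i) → p σ j ≤ p σ i)
    (r : Fin m → ((i : Fin m) → Fin (n i)) → ℝ)
    (hr : ∀ (i : Fin m) (σ : (i : Fin m) → Fin (n i)),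
      r i σ = ∑ j, p σ j * U j (σ j) i)
    -- the first candidate of each party weakly surpasses every other candidate
    (hws : ∀ (i : Fin m) (t : Fin (n i)),
      U i t i ≤ U i ⟨0, by have := hn i; omega⟩ i ∧
      u i t ≤ u i ⟨0, by have := hn i; omega⟩) :
    ∀ (i : Fin m) (s' : Fin (n i)),
      r i (Function.update (fun j => (⟨0, by have := hn j; omega⟩ : Fin (n j))) i s')
        ≤ r i (fun j => (⟨0, by have := hn j; omega⟩ : Fin (n j))) := by
  intro i s'
  set σ : (j : Fin m) → Fin (n j) := fun j => ⟨0, by have := hn j; omega⟩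
  set τ := Function.update σ i s' with hτ
  have hτi : τ i = s' := Function.update_self i s' σ
  have hback : Function.update τ i (σ i) = σ := by
    rw [hτ, Function.update_idem, Function.update_eq_self]
  have hmono := hmono₁ τ i (σ i) (by rw [hτi]; exact (hws i s').2)
  rw [hback] at hmono
  -- Measured relative to the utility of `σ i`, the payoffs compare term by term.
  have hshift : ∀ ρ, r i ρ = ∑ j, p ρ j * (U j (ρ j) i - U i (σ i) i) + U i (σ i) i := by
    intro ρ
    simp only [mul_sub, Finset.sum_sub_distrib, ← Finset.sum_mul, hpsum, hr]
    ring
  rw [hshift τ, hshift σ]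
  gcongr ∑ j, ?_ + _ with j
  by_cases hj : j = i
  · subst hj
    rw [sub_self, mul_zero, hτi]
    exact mul_nonpos_of_nonneg_of_nonpos (hpnn τ j) (sub_nonpos.2 (hws j s').1)
  · have hτj : τ j = σ j := Function.update_of_ne hj s' σ
    rw [hτj]
    exact mul_le_mul_of_nonpos_right (hmono.2 j hj)
      (sub_nonpos.2 (hego i j (Ne.symm hj) (σ i) (σ j)).le)
end

section
/- In an egoistic election game with a monotone WP function, suppose that for every party i the first candidate x_{i,1} weakly surpasses every other candidate x_{i,t} (t ∈ {2,…,n_i}), and that moreover for every party i, every t ∈ {2,…,n_i}, and every profile s with s_i = t, either p_{i,(1,s_{-i})} > p_{i,s}, or both u_i(x_{i,1}) > u_i(x_{i,t}) and p_{i,(1,s_{-i})} > 0. Then the profile (1,1,…,1) is the unique pure-strategy Nash equilibrium of the game. -/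
/-- Change of an expected payoff when the weights move from `p` to `q` and the values from `v`
to `w`, measured relative to the reference value `v i`. -/
lemma sum_mul_sub_sum_mul_eq {ι : Type*} [Fintype ι] {p q : ι → ℝ} (v w : ι → ℝ) (i : ι)
    (hsum : ∑ j, p j = ∑ j, q j) :
    ∑ j, q j * w j - ∑ j, p j * v j
      = ∑ j, (q j * (w j - v j) + (p j - q j) * (v i - v j)) := by
  have h : ∑ j, (p j - q j) * v i = 0 := by
    rw [← Finset.sum_mul, Finset.sum_sub_distrib, hsum, sub_self, zero_mul]
  rw [← Finset.sum_sub_distrib, ← sub_eq_zero, ← Finset.sum_sub_distrib, ← neg_eq_zero,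
    ← Finset.sum_neg_distrib, ← h]
  exact Finset.sum_congr rfl fun j _ => by ring

lemma payoff_change_term_nonneg {ι : Type*} {p q v w : ι → ℝ} {i : ι}
    (hqi : 0 ≤ q i) (hvw : v i ≤ w i) (heq : ∀ j, j ≠ i → w j = v j)
    (hlt : ∀ j, j ≠ i → v j < v i) (hqp : ∀ j, j ≠ i → q j ≤ p j) (j : ι) :
    0 ≤ q j * (w j - v j) + (p j - q j) * (v i - v j) := by
  obtain rfl | hj := eq_or_ne j i
  · simpa using mul_nonneg hqi (sub_nonneg.2 hvw)
  · simpa [heq j hj] using mul_nonneg (sub_nonneg.2 (hqp j hj)) (sub_nonneg.2 (hlt j hj).le)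

/-- Moving weight to the most valuable index `i` and raising its value does not lower the
expected payoff. -/
lemma sum_mul_le_sum_mul_of_shift {ι : Type*} [Fintype ι] {p q v w : ι → ℝ} {i : ι}
    (hsum : ∑ j, p j = ∑ j, q j)
    (hqi : 0 ≤ q i) (hvw : v i ≤ w i) (heq : ∀ j, j ≠ i → w j = v j)
    (hlt : ∀ j, j ≠ i → v j < v i) (hqp : ∀ j, j ≠ i → q j ≤ p j) :
    ∑ j, p j * v j ≤ ∑ j, q j * w j := by
  rw [← sub_nonneg, sum_mul_sub_sum_mul_eq v w i hsum]
  exact Finset.sum_nonneg fun j _ => payoff_change_term_nonneg hqi hvw heq hlt hqp j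

/-- Strict version of `sum_mul_le_sum_mul_of_shift`. -/
lemma sum_mul_lt_sum_mul_of_shift {ι : Type*} [Fintype ι] {p q v w : ι → ℝ} {i : ι}
    (hsum : ∑ j, p j = ∑ j, q j)
    (hqi : 0 ≤ q i) (hvw : v i ≤ w i) (heq : ∀ j, j ≠ i → w j = v j)
    (hlt : ∀ j, j ≠ i → v j < v i) (hqp : ∀ j, j ≠ i → q j ≤ p j)
    (hstrict : p i < q i ∨ (v i < w i ∧ 0 < q i)) :
    ∑ j, p j * v j < ∑ j, q j * w j := by
  rw [← sub_pos, sum_mul_sub_sum_mul_eq v w i hsum]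
  refine Finset.sum_pos' (fun j _ => payoff_change_term_nonneg hqi hvw heq hlt hqp j) ?_
  obtain h | ⟨hv, hq⟩ := hstrict
  · obtain ⟨j, hj⟩ : ∃ j, q j < p j := by
      by_contra! hle
      exact (Finset.sum_lt_sum (fun j _ => hle j) ⟨i, Finset.mem_univ i, h⟩).ne hsum
    have hji : j ≠ i := by
      rintro rfl
      exact h.not_gt hj
    refine ⟨j, Finset.mem_univ j, ?_⟩
    simpa [heq j hji] using mul_pos (sub_pos.2 hj) (sub_pos.2 (hlt j hji))
  · exact ⟨i, Finset.mem_univ i, by simpa using mul_pos hq (sub_pos.2 hv)⟩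

/-- In an egoistic election game with a monotone WP function, suppose for every party `i`
the first candidate weakly surpasses every other candidate of party `i`, and moreover
for every party `i`, every other candidate `t` of party `i`, and every profile `σ` with
`σ i = t`, either switching to the first candidate strictly increases party `i`'s winning
probability, or the first candidate brings strictly more utility to party `i`'s
supporters and wins with positive probability after the switch (i.e. the first candidate
surpasses `t`).  Then the profile in which every party nominates its first candidate is
the unique pure-strategy Nash equilibrium. -/
theorem first_candidates_unique_PSNE
    (m : ℕ) (hm : 2 ≤ m)
    (n : Fin m → ℕ) (hn : ∀ i, 2 ≤ n i)
    (U : (i : Fin m) → Fin (n i) → Fin m → ℝ)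
    (hUpos : ∀ (i : Fin m) (s : Fin (n i)) (j : Fin m), 0 ≤ U i s j)
    (hsorted : ∀ (i : Fin m) (s t : Fin (n i)), s ≤ t → U i t i ≤ U i s i)
    (hego : ∀ i j : Fin m, i ≠ j → ∀ (si : Fin (n i)) (sj : Fin (n j)), U j sj i < U i si i)
    (u : (i : Fin m) → Fin (n i) → ℝ)
    (hu : ∀ (i : Fin m) (s : Fin (n i)), u i s = ∑ j, U i s j)
    (p : ((i : Fin m) → Fin (n i)) → Fin m → ℝ)
    (hpnn : ∀ (σ : (i : Fin m) → Fin (n i)) (i : Fin m), 0 ≤ p σ i)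
    (hpsum : ∀ σ : (i : Fin m) → Fin (n i), ∑ i, p σ i = 1)
    (hmono₁ : ∀ (σ : (i : Fin m) → Fin (n i)) (i : Fin m) (s' : Fin (n i)),
      u i (σ i) ≤ u i s' →
        p σ i ≤ p (Function.update σ i s') i ∧
        ∀ j, j ≠ i → p (Function.update σ i s') j ≤ p σ j)
    (hmono₂ : ∀ (σ : (i : Fin m) → Fin (n i)) (i j : Fin m),
      u j (σ j) < u i (σ i) → p σ j ≤ p σ i)
    (r : Fin m → ((i : Fin m) → Fin (n i)) → ℝ)
    (hr : ∀ (i : Fin m) (σ : (i : Fin m) → Fin (n i)),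
      r i σ = ∑ j, p σ j * U j (σ j) i)
    -- the first candidate of each party weakly surpasses every other candidate
    (hws : ∀ (i : Fin m) (t : Fin (n i)),
      U i t i ≤ U i ⟨0, by have := hn i; omega⟩ i ∧
      u i t ≤ u i ⟨0, by have := hn i; omega⟩)
    -- and in fact surpasses it, in every profile where it is played
    (hsurp : ∀ (i : Fin m) (t : Fin (n i)), t ≠ ⟨0, by have := hn i; omega⟩ →
      ∀ σ : (i : Fin m) → Fin (n i), σ i = t →
        p σ i < p (Function.update σ i ⟨0, by have := hn i; omega⟩) i ∨
        (U i t i < U i ⟨0, by have := hn i; omega⟩ i ∧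
          0 < p (Function.update σ i ⟨0, by have := hn i; omega⟩) i)) :
    (∀ (i : Fin m) (s' : Fin (n i)),
      r i (Function.update (fun j => (⟨0, by have := hn j; omega⟩ : Fin (n j))) i s')
        ≤ r i (fun j => (⟨0, by have := hn j; omega⟩ : Fin (n j)))) ∧
    (∀ σ : (i : Fin m) → Fin (n i),
      (∀ (i : Fin m) (s' : Fin (n i)), r i (Function.update σ i s') ≤ r i σ) →
      σ = fun j => (⟨0, by have := hn j; omega⟩ : Fin (n j))) := by
  have hsum (σ τ : (i : Fin m) → Fin (n i)) : ∑ j, p σ j = ∑ j, p τ j := by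
    rw [hpsum, hpsum]
  have heq (σ : (i : Fin m) → Fin (n i)) (i : Fin m) (s' : Fin (n i)) (j : Fin m)
      (hj : j ≠ i) : U j (Function.update σ i s' j) i = U j (σ j) i := by
    rw [Function.update_of_ne hj]
  have hlt (σ : (i : Fin m) → Fin (n i)) (i j : Fin m) (hj : j ≠ i) :
      U j (σ j) i < U i (σ i) i := hego i j hj.symm _ _
  constructor
  · intro i s'
    set o : (j : Fin m) → Fin (n j) := fun j => ⟨0, by have := hn j; omega⟩
    set σ := Function.update o i s' with hσ
    have ho : Function.update σ i (o i) = o := by simp [hσ]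
    have hqp := (hmono₁ σ i (o i) (hws i (σ i)).2).2
    rw [ho] at hqp
    rw [hr, hr]
    exact sum_mul_le_sum_mul_of_shift (i := i) (hsum σ o) (hpnn o i) (hws i (σ i)).1
      (fun j hj => (heq o i s' j hj).symm) (hlt σ i) hqp
  · intro σ hσ
    funext i
    by_contra hne
    refine (hσ i ⟨0, by have := hn i; omega⟩).not_gt ?_
    rw [hr, hr]
    exact sum_mul_lt_sum_mul_of_shift (i := i) (hsum _ _) (hpnn _ i)
      (by simpa using (hws i (σ i)).1) (heq σ i _) (hlt σ i)
      (hmono₁ σ i _ (hws i (σ i)).2).2 (by simpa using hsurp i (σ i) hne σ rfl)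
end

section
/- In an egoistic election game with a monotone WP function, suppose there exists a set I ⊂ {1,…,m} of m−1 parties such that for every i ∈ I the first candidate x_{i,1} weakly surpasses every other candidate x_{i,t} (t ∈ {2,…,n_i}) of party i. Let j be the remaining party and let s_j^# be a candidate index of party j maximizing ℓ ↦ r_j((1)_{i∈I}, ℓ), i.e., a best response of party j when every party in I nominates its first candidate. Then the profile in which every party in I nominates its first candidate and party j nominates s_j^# is a pure-strategy Nash equilibrium. -/
/-- If party `i` is egoistic and switching from `σ i` to `t` neither lowers the winning probability
of any opponent nor raises the utility of its own candidate for itself, then the switch does not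
increase the payoff of party `i`. -/
theorem payoff_update_le {ι : Type*} [Fintype ι] [DecidableEq ι] {C : ι → Type*}
    (v : (k : ι) → C k → ℝ) (σ : (k : ι) → C k) (i : ι) (t : C i) (q q' : ι → ℝ)
    (hego : ∀ k, k ≠ i → v k (σ k) ≤ v i (σ i)) (hv : v i t ≤ v i (σ i))
    (hq'i : 0 ≤ q' i) (hq : ∑ k, q k = 1) (hq' : ∑ k, q' k = 1)
    (hqq' : ∀ k, k ≠ i → q k ≤ q' k) :
    ∑ k, q' k * v k (Function.update σ i t k) ≤ ∑ k, q k * v k (σ k) := by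
  have key : ∑ k, q k * (v i (σ i) - v k (σ k)) ≤
      ∑ k, q' k * (v i (σ i) - v k (Function.update σ i t k)) := by
    refine Finset.sum_le_sum fun k _ => ?_
    by_cases hk : k = i
    · subst hk
      simpa using mul_nonneg hq'i (sub_nonneg.2 hv)
    · rw [Function.update_of_ne hk]
      exact mul_le_mul_of_nonneg_right (hqq' k hk) (sub_nonneg.2 (hego k hk))
  simp only [mul_sub, Finset.sum_sub_distrib, ← Finset.sum_mul, hq, hq'] at key
  linarith

/-- In an egoistic election game with a monotone WP function, suppose that for all
parties except one party `j`, the first candidate weakly surpasses every other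
candidate of that party.  Let `sj` be a best response of party `j` against the
profile in which every other party nominates its first candidate.  Then the profile
in which every party `i ≠ j` nominates its first candidate and party `j` nominates
`sj` is a pure-strategy Nash equilibrium. -/
theorem almost_dominant_PSNE
    (m : ℕ) (hm : 2 ≤ m)
    (n : Fin m → ℕ) (hn : ∀ i, 2 ≤ n i)
    (U : (i : Fin m) → Fin (n i) → Fin m → ℝ)
    (hUpos : ∀ (i : Fin m) (s : Fin (n i)) (j : Fin m), 0 ≤ U i s j)
    (hsorted : ∀ (i : Fin m) (s t : Fin (n i)), s ≤ t → U i t i ≤ U i s i)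
    (hego : ∀ i j : Fin m, i ≠ j → ∀ (si : Fin (n i)) (sj : Fin (n j)), U j sj i < U i si i)
    (u : (i : Fin m) → Fin (n i) → ℝ)
    (hu : ∀ (i : Fin m) (s : Fin (n i)), u i s = ∑ j, U i s j)
    (p : ((i : Fin m) → Fin (n i)) → Fin m → ℝ)
    (hpnn : ∀ (σ : (i : Fin m) → Fin (n i)) (i : Fin m), 0 ≤ p σ i)
    (hpsum : ∀ σ : (i : Fin m) → Fin (n i), ∑ i, p σ i = 1)
    (hmono₁ : ∀ (σ : (i : Fin m) → Fin (n i)) (i : Fin m) (s' : Fin (n i)),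
      u i (σ i) ≤ u i s' →
        p σ i ≤ p (Function.update σ i s') i ∧
        ∀ j, j ≠ i → p (Function.update σ i s') j ≤ p σ j)
    (hmono₂ : ∀ (σ : (i : Fin m) → Fin (n i)) (i j : Fin m),
      u j (σ j) < u i (σ i) → p σ j ≤ p σ i)
    (r : Fin m → ((i : Fin m) → Fin (n i)) → ℝ)
    (hr : ∀ (i : Fin m) (σ : (i : Fin m) → Fin (n i)),
      r i σ = ∑ j, p σ j * U j (σ j) i)
    -- the distinguished party `j`
    (j : Fin m)
    -- for every party other than `j`, the first candidate weakly surpasses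
    -- every other candidate
    (hws : ∀ i : Fin m, i ≠ j → ∀ t : Fin (n i),
      U i t i ≤ U i ⟨0, by have := hn i; omega⟩ i ∧
      u i t ≤ u i ⟨0, by have := hn i; omega⟩)
    -- `sj` is a best response of party `j` when every other party nominates its
    -- first candidate
    (sj : Fin (n j))
    (hbest : ∀ ℓ : Fin (n j),
      r j (Function.update (fun i => (⟨0, by have := hn i; omega⟩ : Fin (n i))) j ℓ)
        ≤ r j (Function.update (fun i => (⟨0, by have := hn i; omega⟩ : Fin (n i))) j sj)) :
    ∀ (i : Fin m) (s' : Fin (n i)),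
      r i (Function.update
            (Function.update (fun k => (⟨0, by have := hn k; omega⟩ : Fin (n k))) j sj) i s')
        ≤ r i (Function.update (fun k => (⟨0, by have := hn k; omega⟩ : Fin (n k))) j sj) := by
  intro i s'
  by_cases hij : i = j
  · subst hij
    simpa using hbest s'
  · set σ : (k : Fin m) → Fin (n k) :=
      Function.update (fun k => (⟨0, by have := hn k; omega⟩ : Fin (n k))) j sj with hσ
    have hσi : σ i = ⟨0, by have := hn i; omega⟩ := by
      rw [hσ, Function.update_of_ne hij]
    obtain ⟨hU, hu'⟩ := hws i hij s'
    rw [← hσi] at hU hu'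
    have hmono := (hmono₁ (Function.update σ i s') i (σ i) (by simpa using hu')).2
    rw [Function.update_idem, Function.update_eq_self] at hmono
    rw [hr, hr]
    exact payoff_update_le (fun k c => U k c i) σ i s' _ _
      (fun k hk => (hego i k (Ne.symm hk) _ _).le) hU (hpnn _ i) (hpsum _) (hpsum _) hmono
end

section
/- In an egoistic election game with a monotone WP function, let ŝ = (ŝ_1,…,ŝ_m) be a pure-strategy Nash equilibrium and let s* = (s*_1,…,s*_m) be any profile (in particular the profile maximizing social welfare). Then Σ_{i=1}^m u(x_{i,ŝ_i}) ≥ max_{i∈{1,…,m}} u(x_{i,s*_i}). -/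
/-- In an egoistic election game with a monotone WP function, if `shat` is a
pure-strategy Nash equilibrium and `sstar` is any profile (in particular the
socially optimal one), then the sum of the social utilities of the candidates
nominated at `shat` is at least the maximum social utility of any candidate
nominated at `sstar`:
`∑ i, u i (shat i) ≥ max_i u i (sstar i)` (stated as: for every party `i`,
`u i (sstar i) ≤ ∑ j, u j (shat j)`). -/
theorem PSNE_social_utility_vs_optimum
    (m : ℕ) (hm : 2 ≤ m)
    (n : Fin m → ℕ) (hn : ∀ i, 2 ≤ n i)
    (U : (i : Fin m) → Fin (n i) → Fin m → ℝ)
    (hUpos : ∀ (i : Fin m) (s : Fin (n i)) (j : Fin m), 0 ≤ U i s j)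
    (hsorted : ∀ (i : Fin m) (s t : Fin (n i)), s ≤ t → U i t i ≤ U i s i)
    (hego : ∀ i j : Fin m, i ≠ j → ∀ (si : Fin (n i)) (sj : Fin (n j)), U j sj i < U i si i)
    (u : (i : Fin m) → Fin (n i) → ℝ)
    (hu : ∀ (i : Fin m) (s : Fin (n i)), u i s = ∑ j, U i s j)
    (p : ((i : Fin m) → Fin (n i)) → Fin m → ℝ)
    (hpnn : ∀ (σ : (i : Fin m) → Fin (n i)) (i : Fin m), 0 ≤ p σ i)
    (hpsum : ∀ σ : (i : Fin m) → Fin (n i), ∑ i, p σ i = 1)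
    (hmono₁ : ∀ (σ : (i : Fin m) → Fin (n i)) (i : Fin m) (s' : Fin (n i)),
      u i (σ i) ≤ u i s' →
        p σ i ≤ p (Function.update σ i s') i ∧
        ∀ j, j ≠ i → p (Function.update σ i s') j ≤ p σ j)
    (hmono₂ : ∀ (σ : (i : Fin m) → Fin (n i)) (i j : Fin m),
      u j (σ j) < u i (σ i) → p σ j ≤ p σ i)
    (r : Fin m → ((i : Fin m) → Fin (n i)) → ℝ)
    (hr : ∀ (i : Fin m) (σ : (i : Fin m) → Fin (n i)),
      r i σ = ∑ j, p σ j * U j (σ j) i)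
    -- `shat` is a pure-strategy Nash equilibrium
    (shat : (i : Fin m) → Fin (n i))
    (hshat : ∀ (i : Fin m) (s' : Fin (n i)), r i (Function.update shat i s') ≤ r i shat)
    -- `sstar` is an arbitrary profile
    (sstar : (i : Fin m) → Fin (n i)) :
    ∀ i : Fin m, u i (sstar i) ≤ ∑ j, u j (shat j) := by
  intro i
  by_contra! hlt
  have hu_nonneg : ∀ j (s : Fin (n j)), 0 ≤ u j s := fun j s => by
    rw [hu]
    exact Finset.sum_nonneg fun k _ => hUpos j s k
  have hu_lt : ∀ j, u j (shat j) < u i (sstar i) := fun j =>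
    (Finset.single_le_sum (f := fun k => u k (shat k)) (fun k _ => hu_nonneg k _)
      (Finset.mem_univ j)).trans_lt hlt
  -- Otherwise egoism bounds `u i (sstar i)` by the sum of the parties' own utilities at `shat`.
  have hU_lt : U i (shat i) i < U i (sstar i) i := by
    by_contra! hle
    refine hlt.not_ge ?_
    rw [hu]
    refine Finset.sum_le_sum fun j _ => ?_
    have hown : U j (shat j) j ≤ u j (shat j) := by
      rw [hu]
      exact Finset.single_le_sum (fun k _ => hUpos j _ k) (Finset.mem_univ j)
    refine le_trans ?_ hown
    rcases eq_or_ne j i with rfl | hji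
    · exact hle
    · exact (hego j i hji _ _).le
  set τ := Function.update shat i (sstar i)
  have hτi : τ i = sstar i := Function.update_self ..
  have hτj : ∀ j, j ≠ i → τ j = shat j := fun j hj => Function.update_of_ne hj ..
  have hp_pos : 0 < p τ i := by
    by_contra! hp
    have hzero : ∀ j, p τ j ≤ 0 := fun j => by
      rcases eq_or_ne j i with rfl | hj
      · exact hp
      · refine (hmono₂ τ i j ?_).trans hp
        rw [hτi, hτj j hj]
        exact hu_lt j
    linarith [hpsum τ, Finset.sum_nonpos fun j (_ : j ∈ Finset.univ) => hzero j]
  have hr_shift : ∀ σ, ∑ j, p σ j * (U j (σ j) i - U i (shat i) i) = r i σ - U i (shat i) i :=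
    fun σ => by
      simp only [mul_sub, Finset.sum_sub_distrib, ← Finset.sum_mul, hpsum, one_mul, hr]
  have hstrict : p shat i * (U i (shat i) i - U i (shat i) i)
      < p τ i * (U i (τ i) i - U i (shat i) i) := by
    rw [sub_self, mul_zero, hτi]
    exact mul_pos hp_pos (sub_pos.2 hU_lt)
  have hsum : ∑ j, p shat j * (U j (shat j) i - U i (shat i) i)
      < ∑ j, p τ j * (U j (τ j) i - U i (shat i) i) := by
    refine Finset.sum_lt_sum (fun j _ => ?_) ⟨i, Finset.mem_univ i, hstrict⟩
    rcases eq_or_ne j i with rfl | hj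
    · exact hstrict.le
    · rw [hτj j hj]
      exact mul_le_mul_of_nonpos_right ((hmono₁ shat i (sstar i) (hu_lt i).le).2 j hj)
        (sub_nonpos.2 (hego i j hj.symm _ _).le)
  rw [hr_shift, hr_shift] at hsum
  linarith [hshat i (sstar i)]
end

section
/- In an egoistic election game with a monotone WP function, for every pure-strategy Nash equilibrium ŝ and every profile s it holds that SW(s) ≤ m·SW(ŝ). Consequently, whenever the game has a PSNE, its price of anarchy is at most m, the number of parties. -/
open Finset in
/-- If a change of weights with equal totals only shifts mass towards `j`, where `v` is largest,
and the values change only at `j`, then the weighted sum grows by at least the new weight of `j`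
times the change of the value at `j`. -/
theorem weighted_sum_gain_of_shift {ι : Type*} [Fintype ι] (j : ι) (w w' v v' : ι → ℝ)
    (hsum : ∑ k, w k = ∑ k, w' k) (hle : ∀ k, k ≠ j → w' k ≤ w k)
    (hmax : ∀ k, k ≠ j → v k ≤ v j) (hv : ∀ k, k ≠ j → v' k = v k) :
    w' j * (v' j - v j) ≤ ∑ k, w' k * v' k - ∑ k, w k * v k := by
  classical
  have hzero : ∑ k, (w k - w' k) * v j = 0 := by
    rw [← sum_mul, sum_sub_distrib, hsum, sub_self, zero_mul]
  have hsplit : ∑ k, w' k * v' k - ∑ k, w k * v k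
      = ∑ k, w' k * (v' k - v k) + ∑ k, (w k - w' k) * (v j - v k) := by
    have h : ∑ k, (w k - w' k) * (v j - v k)
        = ∑ k, (w k - w' k) * v j - ∑ k, (w k - w' k) * v k := by
      rw [← sum_sub_distrib]
      exact sum_congr rfl fun k _ => by ring
    rw [h, hzero, zero_sub, ← sub_eq_add_neg, ← sum_sub_distrib, ← sum_sub_distrib]
    exact sum_congr rfl fun k _ => by ring
  have hgain : ∑ k, w' k * (v' k - v k) = w' j * (v' j - v j) :=
    sum_eq_single j (fun k _ hk => by rw [hv k hk, sub_self, mul_zero]) (by simp)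
  have hshift : 0 ≤ ∑ k, (w k - w' k) * (v j - v k) := by
    refine sum_nonneg fun k _ => ?_
    rcases eq_or_ne k j with rfl | hk
    · simp
    · exact mul_nonneg (sub_nonneg.2 (hle k hk)) (sub_nonneg.2 (hmax k hk))
  rw [hsplit, hgain]
  linarith

/-- A lower bound valid wherever the weight is nonzero bounds a weighted average. -/
theorem le_weighted_sum_of_weight_ne_zero {ι : Type*} [Fintype ι] (w v : ι → ℝ) (c : ℝ)
    (hw : ∀ k, 0 ≤ w k) (hsum : ∑ k, w k = 1) (h : ∀ k, w k ≠ 0 → c ≤ v k) :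
    c ≤ ∑ k, w k * v k := by
  calc c = ∑ k, w k * c := by rw [← Finset.sum_mul, hsum, one_mul]
    _ ≤ ∑ k, w k * v k := Finset.sum_le_sum fun k _ => by
      rcases eq_or_ne (w k) 0 with hk | hk
      · simp [hk]
      · exact mul_le_mul_of_nonneg_left (h k hk) (hw k)

/-- Price of anarchy bound: in an egoistic election game with a monotone WP function,
for every pure-strategy Nash equilibrium `shat` and every profile `s`,
`SW(s) ≤ m · SW(shat)`.  Consequently, whenever a PSNE exists, the price of anarchy
(the ratio of the optimal social welfare to the social welfare of a worst PSNE) is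
at most `m`, the number of parties. -/
theorem PoA_le_num_parties
    (m : ℕ) (hm : 2 ≤ m)
    (n : Fin m → ℕ) (hn : ∀ i, 2 ≤ n i)
    (U : (i : Fin m) → Fin (n i) → Fin m → ℝ)
    (hUpos : ∀ (i : Fin m) (s : Fin (n i)) (j : Fin m), 0 ≤ U i s j)
    (hsorted : ∀ (i : Fin m) (s t : Fin (n i)), s ≤ t → U i t i ≤ U i s i)
    (hego : ∀ i j : Fin m, i ≠ j → ∀ (si : Fin (n i)) (sj : Fin (n j)), U j sj i < U i si i)
    (u : (i : Fin m) → Fin (n i) → ℝ)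
    (hu : ∀ (i : Fin m) (s : Fin (n i)), u i s = ∑ j, U i s j)
    (p : ((i : Fin m) → Fin (n i)) → Fin m → ℝ)
    (hpnn : ∀ (σ : (i : Fin m) → Fin (n i)) (i : Fin m), 0 ≤ p σ i)
    (hpsum : ∀ σ : (i : Fin m) → Fin (n i), ∑ i, p σ i = 1)
    (hmono₁ : ∀ (σ : (i : Fin m) → Fin (n i)) (i : Fin m) (s' : Fin (n i)),
      u i (σ i) ≤ u i s' →
        p σ i ≤ p (Function.update σ i s') i ∧
        ∀ j, j ≠ i → p (Function.update σ i s') j ≤ p σ j)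
    (hmono₂ : ∀ (σ : (i : Fin m) → Fin (n i)) (i j : Fin m),
      u j (σ j) < u i (σ i) → p σ j ≤ p σ i)
    (r : Fin m → ((i : Fin m) → Fin (n i)) → ℝ)
    (hr : ∀ (i : Fin m) (σ : (i : Fin m) → Fin (n i)),
      r i σ = ∑ j, p σ j * U j (σ j) i)
    -- social welfare
    (SW : ((i : Fin m) → Fin (n i)) → ℝ)
    (hSW : ∀ σ : (i : Fin m) → Fin (n i), SW σ = ∑ j, p σ j * u j (σ j))
    -- `shat` is a pure-strategy Nash equilibrium
    (shat : (i : Fin m) → Fin (n i))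
    (hshat : ∀ (i : Fin m) (s' : Fin (n i)), r i (Function.update shat i s') ≤ r i shat) :
    ∀ s : (i : Fin m) → Fin (n i), SW s ≤ (m : ℝ) * SW shat := by
  have hupos : ∀ i t, 0 ≤ u i t := fun i t => by
    rw [hu]
    exact Finset.sum_nonneg fun j _ => hUpos i t j
  have hcheb : ∑ k, u k (shat k) ≤ (m : ℝ) * SW shat := by
    have hmv : Monovary (p shat) (fun k => u k (shat k)) := fun k l hkl => hmono₂ shat l k hkl
    have := hmv.sum_mul_sum_le_card_mul_sum
    rwa [hpsum, one_mul, Fintype.card_fin, ← hSW] at this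
  have hSWpos : 0 ≤ SW shat := by
    rw [hSW]
    exact Finset.sum_nonneg fun k _ => mul_nonneg (hpnn _ _) (hupos _ _)
  have hcand : ∀ j t, u j t ≤ (m : ℝ) * SW shat := by
    intro j t
    rcases le_or_gt (u j t) (u j (shat j)) with hut | hut
    · exact (hut.trans (Finset.single_le_sum (f := fun k => u k (shat k))
        (fun k _ => hupos _ _) (Finset.mem_univ j))).trans hcheb
    rcases le_or_gt (U j t j) (U j (shat j) j) with hUt | hUt
    · refine le_trans ?_ hcheb
      rw [hu]
      refine Finset.sum_le_sum fun i _ => ?_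
      have hown : U j t i ≤ U i (shat i) i := by
        rcases eq_or_ne i j with rfl | hij
        · exact hUt
        · exact (hego i j hij _ _).le
      rw [hu]
      exact hown.trans (Finset.single_le_sum (f := fun l => U i (shat i) l)
        (fun l _ => hUpos _ _ _) (Finset.mem_univ i))
    -- Deviating to `t` would be profitable, so `j` wins with probability zero even with `t`.
    obtain ⟨hpj, hpk⟩ := hmono₁ shat j t hut.le
    set σ := Function.update shat j t with hσ
    have hσj : σ j = t := by simp [hσ]
    have hσk : ∀ k, k ≠ j → σ k = shat k := fun k hk => by simp [hσ, hk]
    have hgain := weighted_sum_gain_of_shift j (p shat) (p σ) (fun k => U k (shat k) j)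
      (fun k => U k (σ k) j) (by rw [hpsum, hpsum]) hpk
      (fun k hk => (hego j k hk.symm _ _).le) (fun k hk => by simp only [hσk k hk])
    have hdev := hshat j t
    rw [← hσ, hr, hr] at hdev
    have hpσj : p σ j = 0 := by
      simp only [hσj] at hgain
      refine le_antisymm ?_ (hpnn σ j)
      by_contra! hpos
      have := mul_pos hpos (sub_pos.2 hUt)
      linarith
    have hpj0 : p shat j = 0 := le_antisymm (hpj.trans hpσj.le) (hpnn _ _)
    have hple : ∀ k ∈ Finset.univ, p σ k ≤ p shat k := fun k _ => by
      rcases eq_or_ne k j with rfl | hk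
      · rw [hpσj, hpj0]
      · exact hpk k hk
    have hpeq := (Finset.sum_eq_sum_iff_of_le hple).1 (by rw [hpsum, hpsum])
    have hle : u j t ≤ SW shat := by
      rw [hSW]
      refine le_weighted_sum_of_weight_ne_zero _ _ _ (hpnn shat) (hpsum shat) fun k hk0 => ?_
      have hk : k ≠ j := by
        rintro rfl
        exact hk0 hpj0
      by_contra! hlt
      have := hmono₂ σ j k (by rwa [hσj, hσk k hk])
      rw [hpσj, hpeq k (Finset.mem_univ k)] at this
      exact hk0 (le_antisymm this (hpnn _ _))
    have hm1 : (1 : ℝ) ≤ m := by exact_mod_cast (by omega : 1 ≤ m)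
    exact hle.trans (le_mul_of_one_le_left hSWpos hm1)
  intro s
  calc SW s = ∑ k, p s k * u k (s k) := hSW s
    _ ≤ ∑ k, p s k * ((m : ℝ) * SW shat) :=
      Finset.sum_le_sum fun k _ => mul_le_mul_of_nonneg_left (hcand k (s k)) (hpnn s k)
    _ = (m : ℝ) * SW shat := by rw [← Finset.sum_mul, hpsum, one_mul]
end

section
/- Every egoistic election game under the hardmax WP function has a pure-strategy Nash equilibrium. -/
open scoped Classical

/-- `i` is the smallest index at which `v` attains its maximum. -/
def IsHardmaxWinner {ι : Type*} [LinearOrder ι] (v : ι → ℝ) (i : ι) : Prop :=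
  (∀ j, v j ≤ v i) ∧ ∀ j, j < i → v j < v i

namespace IsHardmaxWinner

variable {ι : Type*} [LinearOrder ι] {v v' : ι → ℝ} {i k : ι}

theorem exists_winner [Finite ι] [Nonempty ι] (v : ι → ℝ) : ∃ i, IsHardmaxWinner v i := by
  obtain ⟨i, hi⟩ := Finite.exists_max fun i => toLex (v i, OrderDual.toDual i)
  simp only [Prod.Lex.toLex_le_toLex, OrderDual.toDual_le_toDual] at hi
  refine ⟨i, fun j => ?_, fun j hj => ?_⟩
  · exact (hi j).elim le_of_lt fun h => h.1.le
  · exact (hi j).elim id fun h => absurd h.2 hj.not_ge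

theorem unique (hi : IsHardmaxWinner v i) (hk : IsHardmaxWinner v k) : i = k := by
  rcases lt_trichotomy i k with h | h | h
  · exact absurd (hk.2 i h) (hi.1 k).not_gt
  · exact h
  · exact absurd (hi.2 k h) (hk.1 i).not_gt

/-- A winner still wins when its own value is kept and no other value increases. -/
theorem of_le (hi : IsHardmaxWinner v i) (hle : ∀ j, v' j ≤ v j) (heq : v' i = v i) :
    IsHardmaxWinner v' i :=
  ⟨fun j => heq ▸ (hle j).trans (hi.1 j), fun j hj => heq ▸ (hle j).trans_lt (hi.2 j hj)⟩

end IsHardmaxWinner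

/-- Every egoistic election game under the hardmax WP function has a pure-strategy
Nash equilibrium.  The hardmax WP function gives winning probability `1` to the
party with the smallest index among those whose nominated candidate has maximum
social utility, and `0` to everyone else. -/
theorem hardmax_egoistic_has_PSNE
    (m : ℕ) (hm : 2 ≤ m)
    (n : Fin m → ℕ) (hn : ∀ i, 2 ≤ n i)
    (U : (i : Fin m) → Fin (n i) → Fin m → ℝ)
    (hUpos : ∀ (i : Fin m) (s : Fin (n i)) (j : Fin m), 0 ≤ U i s j)
    (hsorted : ∀ (i : Fin m) (s t : Fin (n i)), s ≤ t → U i t i ≤ U i s i)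
    (hego : ∀ i j : Fin m, i ≠ j → ∀ (si : Fin (n i)) (sj : Fin (n j)), U j sj i < U i si i)
    (u : (i : Fin m) → Fin (n i) → ℝ)
    (hu : ∀ (i : Fin m) (s : Fin (n i)), u i s = ∑ j, U i s j)
    -- the hardmax WP function
    (p : ((i : Fin m) → Fin (n i)) → Fin m → ℝ)
    (hp : ∀ (σ : (i : Fin m) → Fin (n i)) (i : Fin m),
      p σ i = if (∀ j, u j (σ j) ≤ u i (σ i)) ∧ (∀ j, j < i → u j (σ j) < u i (σ i))
              then 1 else 0)
    (r : Fin m → ((i : Fin m) → Fin (n i)) → ℝ)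
    (hr : ∀ (i : Fin m) (σ : (i : Fin m) → Fin (n i)),
      r i σ = ∑ j, p σ j * U j (σ j) i) :
    ∃ σ : (i : Fin m) → Fin (n i),
      ∀ (i : Fin m) (s' : Fin (n i)), r i (Function.update σ i s') ≤ r i σ := by
  have payoff : ∀ (σ : (i : Fin m) → Fin (n i)) (w : Fin m),
      IsHardmaxWinner (fun j => u j (σ j)) w → ∀ i, r i σ = U w (σ w) i := by
    intro σ w hw i
    rw [hr, Finset.sum_eq_single w]
    · rw [(hp σ w).trans (if_pos hw), one_mul]
    · intro k _ hk
      have hlose : ¬ IsHardmaxWinner (fun j => u j (σ j)) k := fun h => hk (h.unique hw)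
      rw [(hp σ k).trans (if_neg hlose), zero_mul]
    · simp
  have : Nonempty (Fin m) := ⟨⟨0, by omega⟩⟩
  have : ∀ i, Nonempty (Fin (n i)) := fun i => ⟨⟨0, by have := hn i; omega⟩⟩
  -- `b` nominates the socially best candidate of every party, and `w` wins under `b`.
  choose b hb using fun i => Finite.exists_max (u i)
  obtain ⟨w, hw⟩ := IsHardmaxWinner.exists_winner fun j => u j (b j)
  -- `t` is the winning nomination against `b` that `w` likes best.
  obtain ⟨t, ht, htmax⟩ := Set.exists_max_image
    {s | IsHardmaxWinner (fun j => u j (Function.update b w s j)) w} (fun s => U w s w)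
    (Set.toFinite _) ⟨b w, by simpa using hw⟩
  refine ⟨Function.update b w t, fun i s' => ?_⟩
  rw [payoff _ w ht i]
  by_cases hi : i = w
  · subst hi
    rw [Function.update_idem, Function.update_self]
    obtain ⟨k, hk⟩ := IsHardmaxWinner.exists_winner fun j => u j (Function.update b i s' j)
    rw [payoff _ k hk i]
    by_cases hki : k = i
    · subst hki
      rw [Function.update_self]
      exact htmax s' hk
    · exact (hego i k (Ne.symm hki) _ _).le
  · have hwin : IsHardmaxWinner
        (fun j => u j (Function.update (Function.update b w t) i s' j)) w := by
      refine IsHardmaxWinner.of_le ht (fun j => ?_) ?_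
      · by_cases hj : j = i
        · subst hj
          rw [Function.update_self, Function.update_of_ne hi]
          exact hb j s'
        · rw [Function.update_of_ne hj]
      · rw [Function.update_of_ne (Ne.symm hi)]
    rw [payoff _ w hwin i, Function.update_of_ne (Ne.symm hi)]
end

section
/- The price-of-anarchy upper bound m is tight under the hardmax WP function: for every integer m ≥ 2 and every real c < m, there exists an egoistic election game of m parties, each with two candidates, under the hardmax WP function, that has a pure-strategy Nash equilibrium ŝ and a profile s with SW(s) > c·SW(ŝ). -/
open scoped Classical

/-- Social utility of candidate `s` of party `i` (each party has two candidates). -/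
noncomputable def socUtil {m : ℕ} (U : Fin m → Fin 2 → Fin m → ℝ)
    (i : Fin m) (s : Fin 2) : ℝ :=
  ∑ j, U i s j

/-- The hardmax WP function: winning probability `1` for the smallest-indexed party
whose nominated candidate has maximum social utility, and `0` otherwise. -/
noncomputable def hardmaxWP {m : ℕ} (U : Fin m → Fin 2 → Fin m → ℝ)
    (σ : Fin m → Fin 2) (i : Fin m) : ℝ :=
  if (∀ j, socUtil U j (σ j) ≤ socUtil U i (σ i)) ∧
     (∀ j, j < i → socUtil U j (σ j) < socUtil U i (σ i))
  then 1 else 0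

/-- Payoff of party `i` at profile `σ` under the hardmax WP function. -/
noncomputable def payoffHM {m : ℕ} (U : Fin m → Fin 2 → Fin m → ℝ)
    (i : Fin m) (σ : Fin m → Fin 2) : ℝ :=
  ∑ j, hardmaxWP U σ j * U j (σ j) i

/-- Social welfare of profile `σ` under the hardmax WP function. -/
noncomputable def swHM {m : ℕ} (U : Fin m → Fin 2 → Fin m → ℝ)
    (σ : Fin m → Fin 2) : ℝ :=
  ∑ j, hardmaxWP U σ j * socUtil U j (σ j)

/-- If the nominee of party `0` has maximum social utility, party `0` wins. -/
theorem hardmaxWP_eq_ite_of_forall_le {n : ℕ} {U : Fin (n + 1) → Fin 2 → Fin (n + 1) → ℝ}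
    {σ : Fin (n + 1) → Fin 2} (h : ∀ j, socUtil U j (σ j) ≤ socUtil U 0 (σ 0))
    (i : Fin (n + 1)) : hardmaxWP U σ i = if i = 0 then 1 else 0 := by
  unfold hardmaxWP
  by_cases hi : i = 0
  · subst hi
    simp [h]
  · rw [if_neg hi, if_neg]
    rintro ⟨-, hlt⟩
    exact absurd (hlt 0 (Fin.pos_iff_ne_zero.2 hi)) (h i).not_gt

/-- Every candidate is worth `1` to its own party and nothing to the others, except that
candidate `1` of party `0` is worth `a` to each other party. -/
noncomputable def tightGame (n : ℕ) (a : ℝ) (i : Fin (n + 1)) (s : Fin 2) (j : Fin (n + 1)) : ℝ :=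
  if i = j then 1 else if i = 0 ∧ s = 1 then a else 0

theorem tightGame_self {n : ℕ} (a : ℝ) (i : Fin (n + 1)) (s : Fin 2) :
    tightGame n a i s i = 1 := by
  simp [tightGame]

theorem tightGame_nonneg {n : ℕ} {a : ℝ} (ha : 0 ≤ a) (i : Fin (n + 1)) (s : Fin 2)
    (j : Fin (n + 1)) : 0 ≤ tightGame n a i s j := by
  unfold tightGame
  split_ifs <;> simp [ha]

theorem tightGame_lt_one {n : ℕ} {a : ℝ} (ha : a < 1) {i j : Fin (n + 1)} (hij : i ≠ j)
    (s : Fin 2) : tightGame n a i s j < 1 := by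
  unfold tightGame
  rw [if_neg hij]
  split_ifs <;> simp [ha]

theorem one_le_socUtil_tightGame {n : ℕ} {a : ℝ} (ha : 0 ≤ a) (i : Fin (n + 1)) (s : Fin 2) :
    1 ≤ socUtil (tightGame n a) i s := by
  rw [← tightGame_self a i s]
  exact Finset.single_le_sum (fun j _ => tightGame_nonneg ha i s j) (Finset.mem_univ i)

theorem socUtil_tightGame_of_ne_zero {n : ℕ} (a : ℝ) {i : Fin (n + 1)} (hi : i ≠ 0) (s : Fin 2) :
    socUtil (tightGame n a) i s = 1 := by
  simp [socUtil, tightGame, hi]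

theorem socUtil_tightGame_zero_zero (n : ℕ) (a : ℝ) : socUtil (tightGame n a) 0 0 = 1 := by
  simp [socUtil, tightGame]

theorem socUtil_tightGame_zero_one (n : ℕ) (a : ℝ) :
    socUtil (tightGame n a) 0 1 = 1 + n * a := by
  simp [socUtil, tightGame, Fin.sum_univ_succ, (Fin.succ_ne_zero _).symm]

theorem hardmaxWP_tightGame {n : ℕ} {a : ℝ} (ha : 0 ≤ a) (σ : Fin (n + 1) → Fin 2)
    (i : Fin (n + 1)) : hardmaxWP (tightGame n a) σ i = if i = 0 then 1 else 0 := by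
  refine hardmaxWP_eq_ite_of_forall_le (fun j => ?_) i
  by_cases hj : j = 0
  · rw [hj]
  · rw [socUtil_tightGame_of_ne_zero a hj]
    exact one_le_socUtil_tightGame ha 0 (σ 0)

theorem payoffHM_tightGame {n : ℕ} {a : ℝ} (ha : 0 ≤ a) (i : Fin (n + 1))
    (σ : Fin (n + 1) → Fin 2) : payoffHM (tightGame n a) i σ = tightGame n a 0 (σ 0) i := by
  simp [payoffHM, hardmaxWP_tightGame ha]

theorem swHM_tightGame {n : ℕ} {a : ℝ} (ha : 0 ≤ a) (σ : Fin (n + 1) → Fin 2) :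
    swHM (tightGame n a) σ = socUtil (tightGame n a) 0 (σ 0) := by
  simp [swHM, hardmaxWP_tightGame ha]

/-- Every real below `n + 1` is exceeded by `1 + n * a` for some `a ∈ [0, 1)`. -/
theorem exists_lt_one_add_mul {n : ℕ} {c : ℝ} (hc : c < n + 1) :
    ∃ a : ℝ, 0 ≤ a ∧ a < 1 ∧ c < 1 + n * a := by
  have hn : (0 : ℝ) < n + 1 := by positivity
  have hε : 0 < (n + 1 - c) / (n + 1) := div_pos (by linarith) hn
  refine ⟨max 0 (1 - (n + 1 - c) / (n + 1)), le_max_left _ _,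
    max_lt one_pos (by linarith), ?_⟩
  have hmul : (n + 1 - c) / (n + 1) * (n + 1) = n + 1 - c := div_mul_cancel₀ _ hn.ne'
  have hle := mul_le_mul_of_nonneg_left
    (le_max_right 0 (1 - (n + 1 - c) / (n + 1))) (Nat.cast_nonneg (α := ℝ) n)
  linarith

/-- Tightness of the price-of-anarchy bound `m` under the hardmax WP function:
for every `m ≥ 2` and every real `c < m` there is an egoistic election game of
`m` parties, each with two candidates (sorted, with nonnegative utilities), that has
a pure-strategy Nash equilibrium `shat` and a profile `s` with `SW(s) > c · SW(shat)`. -/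
theorem hardmax_PoA_tight (m : ℕ) (hm : 2 ≤ m) (c : ℝ) (hc : c < m) :
    ∃ U : Fin m → Fin 2 → Fin m → ℝ,
      (∀ (i : Fin m) (s : Fin 2) (j : Fin m), 0 ≤ U i s j) ∧
      (∀ (i : Fin m) (s t : Fin 2), s ≤ t → U i t i ≤ U i s i) ∧
      (∀ i j : Fin m, i ≠ j → ∀ si sj : Fin 2, U j sj i < U i si i) ∧
      ∃ shat s : Fin m → Fin 2,
        (∀ (i : Fin m) (s' : Fin 2),
          payoffHM U i (Function.update shat i s') ≤ payoffHM U i shat) ∧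
        c * swHM U shat < swHM U s := by
  obtain ⟨n, rfl⟩ : ∃ n, m = n + 1 := ⟨m - 1, by omega⟩
  obtain ⟨a, ha0, ha1, hca⟩ := exists_lt_one_add_mul (n := n) (c := c) (by exact_mod_cast hc)
  refine ⟨tightGame n a, tightGame_nonneg ha0, fun i s t _ => ?_, fun i j hij si sj => ?_,
    fun _ => 0, fun _ => 1, fun i s' => ?_, ?_⟩
  · rw [tightGame_self, tightGame_self]
  · rw [tightGame_self]
    exact tightGame_lt_one ha1 hij.symm sj
  · rw [payoffHM_tightGame ha0, payoffHM_tightGame ha0]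
    by_cases hi : i = 0
    · rw [hi, tightGame_self, tightGame_self]
    · rw [Function.update_of_ne (Ne.symm hi)]
  · rw [swHM_tightGame ha0, swHM_tightGame ha0, socUtil_tightGame_zero_zero,
      socUtil_tightGame_zero_one, mul_one]
    exact hca
end

section
/- There exists an egoistic election game of three parties, each with exactly two candidates and with all social utilities lying in [0, 100], such that under the softmax WP function with parameter β = 100 the game has no pure-strategy Nash equilibrium. -/
/-- Social utility of candidate `s` of party `i` in a three-party game where each
party has two candidates. -/
noncomputable def socUtil3 (U : Fin 3 → Fin 2 → Fin 3 → ℝ) (i : Fin 3) (s : Fin 2) : ℝ :=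
  ∑ j, U i s j

/-- The softmax WP function with parameter `β = 100`. -/
noncomputable def softmaxWP100 (U : Fin 3 → Fin 2 → Fin 3 → ℝ)
    (σ : Fin 3 → Fin 2) (i : Fin 3) : ℝ :=
  Real.exp (socUtil3 U i (σ i) / 100) / ∑ j, Real.exp (socUtil3 U j (σ j) / 100)

/-- Payoff of party `i` at profile `σ` under the softmax WP function with `β = 100`. -/
noncomputable def payoffSM100 (U : Fin 3 → Fin 2 → Fin 3 → ℝ)
    (i : Fin 3) (σ : Fin 3 → Fin 2) : ℝ :=
  ∑ j, softmaxWP100 U σ j * U j (σ j) i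

/-- The entry `cyclingUtil i s j` is the utility that candidate `s` of party `i` brings to the
supporters of party `j`. -/
noncomputable def cyclingUtil : Fin 3 → Fin 2 → Fin 3 → ℝ :=
  ![![![40, 5, 5], ![29, 20, 51]], ![![6, 44, 0], ![4, 36, 60]], ![![1, 18, 81], ![8, 28, 64]]]

/-- The exponential weight `exp (u / 100)` of each candidate of `cyclingUtil`, divided by
`exp (1 / 2)`. -/
noncomputable def cyclingWeight : Fin 3 → Fin 2 → ℝ :=
  ![![1, Real.exp (1 / 2)], ![1, Real.exp (1 / 2)], ![Real.exp (1 / 2), Real.exp (1 / 2)]]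

lemma exp_one_eq_exp_half_mul_self : Real.exp 1 = Real.exp (1 / 2) * Real.exp (1 / 2) := by
  rw [← Real.exp_add]; norm_num

lemma socUtil3_cyclingUtil (i : Fin 3) (s : Fin 2) :
    socUtil3 cyclingUtil i s = ![![50, 100], ![50, 100], ![100, 100]] i s := by
  fin_cases i <;> fin_cases s <;> simp [socUtil3, cyclingUtil, Fin.sum_univ_three] <;> norm_num

lemma exp_socUtil3_cyclingUtil (i : Fin 3) (s : Fin 2) :
    Real.exp (socUtil3 cyclingUtil i s / 100) = Real.exp (1 / 2) * cyclingWeight i s := by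
  rw [socUtil3_cyclingUtil]
  fin_cases i <;> fin_cases s <;>
    norm_num [cyclingWeight, exp_one_eq_exp_half_mul_self]

lemma payoffSM100_cyclingUtil (i : Fin 3) (σ : Fin 3 → Fin 2) :
    payoffSM100 cyclingUtil i σ =
      (∑ j, cyclingWeight j (σ j) * cyclingUtil j (σ j) i) / ∑ j, cyclingWeight j (σ j) := by
  simp only [payoffSM100, softmaxWP100, exp_socUtil3_cyclingUtil, ← Finset.mul_sum,
    mul_div_mul_left _ _ (Real.exp_ne_zero (1 / 2)), Finset.sum_div]
  exact Finset.sum_congr rfl fun j _ => by ring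

lemma exp_half_mem_Ioo : Real.exp (1 / 2) ∈ Set.Ioo (1.6487 : ℝ) 1.6488 := by
  have hsq := exp_one_eq_exp_half_mul_self
  have hpos := Real.exp_pos (1 / 2)
  have hlo := Real.exp_one_gt_d9
  have hhi := Real.exp_one_lt_d9
  constructor <;> nlinarith

/-- In the game `cyclingUtil`, this is a profitable unilateral deviation (party, new candidate)
from the profile `(a, b, c)`. -/
def cyclingDeviation : Fin 2 → Fin 2 → Fin 2 → Fin 3 × Fin 2 :=
  ![![![(1, 1), (2, 0)], ![(0, 1), (2, 0)]], ![![(0, 0), (2, 0)], ![(1, 0), (2, 0)]]]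

lemma payoffSM100_lt_cyclingDeviation (a b c : Fin 2) :
    payoffSM100 cyclingUtil (cyclingDeviation a b c).1 ![a, b, c] <
      payoffSM100 cyclingUtil (cyclingDeviation a b c).1
        (Function.update ![a, b, c] (cyclingDeviation a b c).1 (cyclingDeviation a b c).2) := by
  obtain ⟨hlo, hhi⟩ := exp_half_mem_Ioo
  have hpos := Real.exp_pos (1 / 2)
  simp only [payoffSM100_cyclingUtil]
  generalize hx : Real.exp (1 / 2) = x at *
  fin_cases a <;> fin_cases b <;> fin_cases c <;>
    simp [cyclingDeviation, cyclingUtil, cyclingWeight, Fin.sum_univ_three, Function.update,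
      -one_div, hx] <;>
    rw [div_lt_div_iff₀ (by positivity) (by positivity)] <;>
    nlinarith

/-- There exists an egoistic election game of three parties, each with exactly two
candidates (sorted, nonnegative utilities) and all social utilities in `[0, 100]`,
which has no pure-strategy Nash equilibrium under the softmax WP function with
parameter `β = 100`. -/
theorem softmax_three_party_no_PSNE :
    ∃ U : Fin 3 → Fin 2 → Fin 3 → ℝ,
      (∀ (i : Fin 3) (s : Fin 2) (j : Fin 3), 0 ≤ U i s j) ∧
      (∀ (i : Fin 3) (s : Fin 2), 0 ≤ socUtil3 U i s ∧ socUtil3 U i s ≤ 100) ∧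
      (∀ (i : Fin 3) (s t : Fin 2), s ≤ t → U i t i ≤ U i s i) ∧
      (∀ i j : Fin 3, i ≠ j → ∀ si sj : Fin 2, U j sj i < U i si i) ∧
      ∀ σ : Fin 3 → Fin 2, ∃ (i : Fin 3) (s' : Fin 2),
        payoffSM100 U i σ < payoffSM100 U i (Function.update σ i s') := by
  refine ⟨cyclingUtil, ?_, ?_, ?_, ?_, fun σ => ?_⟩
  · intro i s j
    fin_cases i <;> fin_cases s <;> fin_cases j <;> norm_num [cyclingUtil]
  · intro i s
    rw [socUtil3_cyclingUtil]
    fin_cases i <;> fin_cases s <;> norm_num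
  · intro i s t hst
    fin_cases i <;> fin_cases s <;> fin_cases t <;> first
      | exact absurd hst (by decide)
      | norm_num [cyclingUtil]
  · intro i j hij s t
    fin_cases i <;> fin_cases j <;> first
      | exact absurd rfl hij
      | (fin_cases s <;> fin_cases t <;> norm_num [cyclingUtil])
  · have hσ : σ = ![σ 0, σ 1, σ 2] := by
      ext j; fin_cases j <;> rfl
    rw [hσ]
    exact ⟨_, _, payoffSM100_lt_cyclingDeviation (σ 0) (σ 1) (σ 2)⟩
end

section
/- In an egoistic election game in which every candidate's social utility lies in [0, β] and the WP function is the softmax function with parameter β, the profile (1,1,…,1) in which every party nominates its first candidate is a (1+e)-approximate pure-strategy Nash equilibrium, where e is Euler's number: for every party i and every candidate index s'_i, r_i(s'_i, (1,…,1)_{-i}) ≤ (1+e)·r_i(1,…,1). -/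
/-- Replacing the weight `a` and value `x` of one term in a weighted average by `a' ≤ k * a` and
`x' ≤ x` multiplies the average by at most `k`, provided `x` dominates the average `C / B` of the
remaining terms. -/
lemma weighted_average_update_le {a a' x x' B C k : ℝ} (ha : 0 < a) (ha' : 0 < a')
    (hx : 0 ≤ x) (hB : 0 ≤ B) (hC : 0 ≤ C) (hk : 1 ≤ k) (hak : a' ≤ k * a)
    (hxx : x' ≤ x) (hCB : C ≤ B * x) :
    (a' * x' + C) / (a' + B) ≤ k * ((a * x + C) / (a + B)) := by
  calc (a' * x' + C) / (a' + B) ≤ (a' * x + C) / (a' + B) := by gcongr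
    _ ≤ k * ((a * x + C) / (a + B)) := by
      rcases le_total a a' with h | h
      · calc (a' * x + C) / (a' + B) ≤ (k * a * x + k * C) / (a + B) := by
              gcongr
              exact le_mul_of_one_le_left hC hk
          _ = k * ((a * x + C) / (a + B)) := by ring
      · calc (a' * x + C) / (a' + B) ≤ (a * x + C) / (a + B) := by
              rw [div_le_div_iff₀ (by positivity) (by positivity)]
              nlinarith [mul_nonneg (sub_nonneg.2 h) (sub_nonneg.2 hCB)]
          _ ≤ k * ((a * x + C) / (a + B)) := le_mul_of_one_le_left (by positivity) hk

/-- In an egoistic election game with all social utilities in `[0, β]` and the softmax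
WP function with parameter `β`, the profile in which every party nominates its first
candidate is a `(1+e)`-approximate pure-strategy Nash equilibrium: no unilateral
deviation gives any party more than `(1 + e)` times its payoff at that profile. -/
theorem first_candidates_approx_PSNE
    (m : ℕ) (hm : 2 ≤ m)
    (n : Fin m → ℕ) (hn : ∀ i, 2 ≤ n i)
    (β : ℝ) (hβ : 0 < β)
    (U : (i : Fin m) → Fin (n i) → Fin m → ℝ)
    (hUpos : ∀ (i : Fin m) (s : Fin (n i)) (j : Fin m), 0 ≤ U i s j)
    (hsorted : ∀ (i : Fin m) (s t : Fin (n i)), s ≤ t → U i t i ≤ U i s i)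
    (hego : ∀ i j : Fin m, i ≠ j → ∀ (si : Fin (n i)) (sj : Fin (n j)), U j sj i < U i si i)
    (u : (i : Fin m) → Fin (n i) → ℝ)
    (hu : ∀ (i : Fin m) (s : Fin (n i)), u i s = ∑ j, U i s j)
    -- every candidate's social utility lies in [0, β]
    (husoc : ∀ (i : Fin m) (s : Fin (n i)), 0 ≤ u i s ∧ u i s ≤ β)
    -- the softmax WP function with parameter β
    (p : ((i : Fin m) → Fin (n i)) → Fin m → ℝ)
    (hp : ∀ (σ : (i : Fin m) → Fin (n i)) (i : Fin m),
      p σ i = Real.exp (u i (σ i) / β) / ∑ j, Real.exp (u j (σ j) / β))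
    (r : Fin m → ((i : Fin m) → Fin (n i)) → ℝ)
    (hr : ∀ (i : Fin m) (σ : (i : Fin m) → Fin (n i)),
      r i σ = ∑ j, p σ j * U j (σ j) i) :
    ∀ (i : Fin m) (s' : Fin (n i)),
      r i (Function.update (fun j => (⟨0, by have := hn j; omega⟩ : Fin (n j))) i s')
        ≤ (1 + Real.exp 1) * r i (fun j => (⟨0, by have := hn j; omega⟩ : Fin (n j))) := by
  intro i s'
  set τ : (j : Fin m) → Fin (n j) := fun j => ⟨0, by have := hn j; omega⟩
  set B := ∑ j ∈ Finset.univ.erase i, Real.exp (u j (τ j) / β) with hB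
  set C := ∑ j ∈ Finset.univ.erase i, Real.exp (u j (τ j) / β) * U j (τ j) i with hC
  have payoff_update (t : Fin (n i)) : r i (Function.update τ i t) =
      (Real.exp (u i t / β) * U i t i + C) / (Real.exp (u i t / β) + B) := by
    simp only [hr, hp, div_mul_eq_mul_div]
    rw [← Finset.sum_div, ← Finset.add_sum_erase _ _ (Finset.mem_univ i),
      ← Finset.add_sum_erase _ (fun j => Real.exp (u j (Function.update τ i t j) / β))
        (Finset.mem_univ i), hB, hC]
    simp only [Function.update_self]
    congr 2 <;> refine Finset.sum_congr rfl fun j hj => ?_ <;>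
      rw [Function.update_of_ne (Finset.ne_of_mem_erase hj)]
  have payoff_first := payoff_update (τ i)
  rw [Function.update_eq_self] at payoff_first
  have hB0 : 0 ≤ B := Finset.sum_nonneg fun j _ => (Real.exp_pos _).le
  have hC0 : 0 ≤ C := Finset.sum_nonneg fun j _ => mul_nonneg (Real.exp_pos _).le (hUpos _ _ _)
  have hCB : C ≤ B * U i (τ i) i := by
    rw [hB, hC, Finset.sum_mul]
    exact Finset.sum_le_sum fun j hj => mul_le_mul_of_nonneg_left
      (hego i j (Finset.ne_of_mem_erase hj).symm _ _).le (Real.exp_pos _).le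
  have hweight : Real.exp (u i s' / β) ≤ (1 + Real.exp 1) * Real.exp (u i (τ i) / β) := by
    have h₁ : u i s' / β ≤ 1 := (div_le_one hβ).2 (husoc i s').2
    have h₂ : 0 ≤ u i (τ i) / β := div_nonneg (husoc i (τ i)).1 hβ.le
    calc Real.exp (u i s' / β) ≤ 1 + Real.exp 1 := by linarith [Real.exp_le_exp.2 h₁]
      _ ≤ (1 + Real.exp 1) * Real.exp (u i (τ i) / β) :=
        le_mul_of_one_le_right (by positivity) (Real.one_le_exp h₂)
  rw [payoff_update s', payoff_first]
  exact weighted_average_update_le (Real.exp_pos _) (Real.exp_pos _) (hUpos _ _ _) hB0 hC0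
    (by linarith [Real.exp_pos 1]) hweight (hsorted i _ _ (Nat.zero_le _)) hCB
end

section
/- In a strongly egoistic election game, the induced coalition game is egoistic: let C_1,…,C_{m'} be pairwise disjoint nonempty sets of parties, and for each coalition C_i let a coalition candidate z_i assign to each member party Q ∈ C_i a candidate index z_i(Q) ∈ {1,…,n_Q}; define ũ_j(z_i) = Σ_{P ∈ C_j} Σ_{Q ∈ C_i} u_P(x_{Q, z_i(Q)}). Then for all i ≠ j and all coalition candidates z_i of C_i and z_j of C_j, ũ_i(z_i) > ũ_i(z_j). -/
/-- In a strongly egoistic election game, the induced coalition game is egoistic: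
if `C 1, …, C m'` are pairwise disjoint nonempty coalitions of parties, a coalition
candidate of a coalition picks one candidate per member party, and the utility of a
coalition candidate `z` of coalition `C j` for coalition `C i` is
`ũ_i(z) = ∑_{P ∈ C i} ∑_{Q ∈ C j} u_P(x_{Q, z Q})`, then for all `i ≠ j` and all
coalition candidates `zi` of `C i` and `zj` of `C j` we have `ũ_i(zi) > ũ_i(zj)`. -/
theorem strongly_egoistic_coalition_game_egoistic
    (m : ℕ) (hm : 2 ≤ m)
    (n : Fin m → ℕ) (hn : ∀ i, 2 ≤ n i)
    (U : (i : Fin m) → Fin (n i) → Fin m → ℝ)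
    (hUpos : ∀ (i : Fin m) (s : Fin (n i)) (j : Fin m), 0 ≤ U i s j)
    -- strong egoism: every candidate benefits its own party's supporters more than
    -- all other parties' best candidates jointly do
    (hse : ∀ (i : Fin m) (s : Fin (n i)),
      ∑ j ∈ Finset.univ.erase i,
        Finset.univ.sup'
          (Finset.univ_nonempty_iff.mpr ⟨(⟨0, by have := hn j; omega⟩ : Fin (n j))⟩)
          (fun t : Fin (n j) => U j t i)
        < U i s i)
    -- pairwise disjoint nonempty coalitions
    (m' : ℕ) (C : Fin m' → Finset (Fin m))
    (hCne : ∀ i, (C i).Nonempty)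
    (hCdisj : ∀ i j : Fin m', i ≠ j → Disjoint (C i) (C j))
    -- two distinct coalitions and coalition candidates for them
    (i j : Fin m') (hij : i ≠ j)
    (zi zj : (Q : Fin m) → Fin (n Q)) :
    ∑ P ∈ C i, ∑ Q ∈ C j, U Q (zj Q) P < ∑ P ∈ C i, ∑ Q ∈ C i, U Q (zi Q) P := by
  refine Finset.sum_lt_sum_of_nonempty (hCne i) fun P hP => ?_
  have hPj : P ∉ C j := Finset.disjoint_left.mp (hCdisj i j hij) hP
  calc ∑ Q ∈ C j, U Q (zj Q) P
      ≤ ∑ Q ∈ Finset.univ.erase P, U Q (zj Q) P :=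
        Finset.sum_le_sum_of_subset_of_nonneg
          (Finset.subset_erase.mpr ⟨Finset.subset_univ _, hPj⟩)
          fun Q _ _ => hUpos Q (zj Q) P
    _ ≤ _ := Finset.sum_le_sum fun Q _ =>
        Finset.le_sup' (fun t : Fin (n Q) => U Q t P) (Finset.mem_univ (zj Q))
    _ < U P (zi P) P := hse P (zi P)
    _ ≤ ∑ Q ∈ C i, U Q (zi Q) P :=
        Finset.single_le_sum (f := fun Q => U Q (zi Q) P) (fun Q _ => hUpos Q (zi Q) P) hP
end

section
/- In a strongly egoistic election game, a party never gains by leaving a coalition: let C_1,…,C_{m'} be pairwise disjoint nonempty sets of parties with P ∈ C_i, and fix a coalition candidate z_j (one candidate x_{Q,z_j(Q)} per member party Q) for each coalition C_j. Let p_1,…,p_{m'} ≥ 0 with Σ_j p_j = 1 (winning probabilities when P belongs to C_i) and let p'_1,…,p'_{m'}, p̂ ≥ 0 with p̂ + Σ_j p'_j = 1 (winning probabilities when P competes separately from C_i, p̂ being P's own winning probability), and assume p'_i ≤ p_i and p'_j ≥ p_j for every j ≠ i. Then p̂·u_P(x_{P,z_i(P)}) + p'_i·Σ_{Q∈C_i,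 Q≠P} u_P(x_{Q,z_i(Q)}) + Σ_{j≠i} p'_j·Σ_{Q∈C_j} u_P(x_{Q,z_j(Q)}) ≤ Σ_{j=1}^{m'} p_j·Σ_{Q∈C_j} u_P(x_{Q,z_j(Q)}); that is, P's expected utility when separate is at most its expected utility inside the coalition. -/
/-- In a strongly egoistic election game, a party never gains by leaving a coalition:
let `C 1, …, C m'` be pairwise disjoint nonempty coalitions of parties with `P ∈ C i`,
and fix a coalition candidate `z j` for each coalition `C j`.  Let `p j ≥ 0` with
`∑ j, p j = 1` be the winning probabilities when `P` belongs to `C i`, and let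
`phat, p' j ≥ 0` with `phat + ∑ j, p' j = 1` be the winning probabilities when `P`
competes separately (with `phat` its own winning probability), where `p' i ≤ p i`
and `p' j ≥ p j` for every `j ≠ i`.  Then `P`'s expected utility when separate is
at most its expected utility inside the coalition. -/
theorem no_gain_from_leaving_coalition
    (m : ℕ) (hm : 2 ≤ m)
    (n : Fin m → ℕ) (hn : ∀ i, 2 ≤ n i)
    (U : (i : Fin m) → Fin (n i) → Fin m → ℝ)
    (hUpos : ∀ (i : Fin m) (s : Fin (n i)) (j : Fin m), 0 ≤ U i s j)
    -- strong egoism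
    (hse : ∀ (i : Fin m) (s : Fin (n i)),
      ∑ j ∈ Finset.univ.erase i,
        Finset.univ.sup'
          (Finset.univ_nonempty_iff.mpr ⟨(⟨0, by have := hn j; omega⟩ : Fin (n j))⟩)
          (fun t : Fin (n j) => U j t i)
        < U i s i)
    -- pairwise disjoint nonempty coalitions, the party `P` belonging to coalition `i`
    (m' : ℕ) (C : Fin m' → Finset (Fin m))
    (hCne : ∀ j, (C j).Nonempty)
    (hCdisj : ∀ j k : Fin m', j ≠ k → Disjoint (C j) (C k))
    (i : Fin m') (P : Fin m) (hP : P ∈ C i)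
    -- a coalition candidate for each coalition
    (z : Fin m' → (Q : Fin m) → Fin (n Q))
    -- winning probabilities when `P` is inside coalition `i`
    (p : Fin m' → ℝ) (hp : ∀ j, 0 ≤ p j) (hpsum : ∑ j, p j = 1)
    -- winning probabilities when `P` competes separately from coalition `i`
    (p' : Fin m' → ℝ) (hp' : ∀ j, 0 ≤ p' j)
    (phat : ℝ) (hphat : 0 ≤ phat)
    (hp'sum : phat + ∑ j, p' j = 1)
    (hpi : p' i ≤ p i)
    (hpj : ∀ j : Fin m', j ≠ i → p j ≤ p' j) :
    phat * U P (z i P) P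
      + p' i * ∑ Q ∈ (C i).erase P, U Q (z i Q) P
      + ∑ j ∈ Finset.univ.erase i, p' j * ∑ Q ∈ C j, U Q (z j Q) P
    ≤ ∑ j, p j * ∑ Q ∈ C j, U Q (z j Q) P := by
  have hother : ∀ j ∈ Finset.univ.erase i, ∑ Q ∈ C j, U Q (z j Q) P ≤ U P (z i P) P := by
    intro j hj
    have hPj : P ∉ C j :=
      Finset.disjoint_left.mp (hCdisj i j (Finset.ne_of_mem_erase hj).symm) hP
    have hsub : C j ⊆ Finset.univ.erase P := fun Q hQ =>
      Finset.mem_erase.mpr ⟨fun h => hPj (h ▸ hQ), Finset.mem_univ Q⟩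
    refine le_trans ?_ (hse P (z i P)).le
    refine (Finset.sum_le_sum_of_subset_of_nonneg hsub fun Q _ _ => hUpos Q (z j Q) P).trans ?_
    exact Finset.sum_le_sum fun Q _ =>
      Finset.le_sup' (fun t : Fin (n Q) => U Q t P) (Finset.mem_univ (z j Q))
  have hshift : ∑ j ∈ Finset.univ.erase i, (p' j - p j) * ∑ Q ∈ C j, U Q (z j Q) P
      ≤ ∑ j ∈ Finset.univ.erase i, (p' j - p j) * U P (z i P) P :=
    Finset.sum_le_sum fun j hj => mul_le_mul_of_nonneg_left (hother j hj)
      (sub_nonneg.mpr (hpj j (Finset.ne_of_mem_erase hj)))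
  rw [← Finset.sum_mul] at hshift
  simp only [sub_mul, Finset.sum_sub_distrib] at hshift
  have hpartners : 0 ≤ ∑ Q ∈ (C i).erase P, U Q (z i Q) P :=
    Finset.sum_nonneg fun Q _ => hUpos Q (z i Q) P
  rw [← Finset.add_sum_erase _ _ (Finset.mem_univ i)] at hpsum hp'sum ⊢
  rw [← Finset.add_sum_erase (C i) _ hP]
  rw [eq_sub_of_add_eq' hpsum,
    show ∑ j ∈ Finset.univ.erase i, p' j = 1 - phat - p' i by linarith] at hshift
  linarith [mul_nonneg (hp' i) (hUpos P (z i P) P),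
    mul_nonneg (sub_nonneg.mpr hpi) hpartners]
end
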